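/- arXiv:0811.3750 — 8 statements merged into one kernel-verified Lean document; each statement's English description precedes it below -/
import Mathlib

section
/- Let α, β be positive reals with α ≠ β, let Φ : ℝ^d → ℂ be continuous, and fix y ∈ ℝ^d. Then ∫₀¹ ∫₀¹ Φ(s^{1/β} t^{1/α} y) dt ds = (β/(β−α)) ∫₀¹ Φ(u y)·α u^{α−1} du − (α/(β−α)) ∫₀¹ Φ(u y)·β u^{β−1} du; in other words, the composed double integral equals ∫₀¹ Φ(u y) r′_{(α,β)}(u) du, where r_{(α,β)}(u) := (β/(β−α)) u^α − (α/(β−α)) u^β. (Proposition 1, stated at the level of Lévy exponents: the left side is the Lévy exponent of 𝒥^α(𝒥^β(ν)) and the right side that of the random integral with time change r_{(α,β)}.) -/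
open MeasureTheory

section PowerSubstitution

open Set

variable {E : Type*} [NormedAddCommGroup E] [NormedSpace ℝ E]

lemma intervalIntegrable_rpow_weight_smul {a : ℝ} (ha : 0 < a) {h : ℝ → E} (hh : Continuous h)
    (x y : ℝ) :
    IntervalIntegrable (fun u : ℝ => (a * u ^ (a - 1)) • h u) volume x y :=
  ((intervalIntegral.intervalIntegrable_rpow' (by linarith)).const_mul a).smul_continuousOn
    hh.continuousOn

lemma integral_comp_rpow_one_div {a : ℝ} (ha : 0 < a) {h : ℝ → E} (hh : Continuous h) :
    ∫ t in (0:ℝ)..1, h (t ^ (1 / a)) = ∫ u in (0:ℝ)..1, (a * u ^ (a - 1)) • h u := by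
  have hcont : Continuous fun t : ℝ => h (t ^ (1 / a)) :=
    hh.comp (Real.continuous_rpow_const (by positivity))
  have hpow : Continuous fun u : ℝ => u ^ a := Real.continuous_rpow_const ha.le
  have hinv : ∀ u ∈ uIcc (0:ℝ) 1, (u ^ a) ^ (1 / a) = u := fun u hu => by
    rw [uIcc_of_le zero_le_one] at hu
    rw [one_div, Real.rpow_rpow_inv hu.1 ha.ne']
  have key := intervalIntegral.integral_deriv_smul_comp''' (a := 0) (b := 1)
    (f := fun u : ℝ => u ^ a) (f' := fun u : ℝ => a * u ^ (a - 1))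
    (g := fun t : ℝ => h (t ^ (1 / a))) hpow.continuousOn
    (fun u hu => (Real.hasDerivAt_rpow_const
      (Or.inl (by simpa using hu.1.ne'))).hasDerivWithinAt)
    hcont.continuousOn
    (hcont.continuousOn.integrableOn_compact (isCompact_uIcc.image hpow))
    ((intervalIntegrable_iff' (by simp)).1
      (intervalIntegrable_rpow_weight_smul ha (hcont.comp hpow) 0 1))
  simp only [Function.comp_apply, Real.zero_rpow ha.ne', Real.one_rpow] at key
  rw [← key]
  exact intervalIntegral.integral_congr fun u hu => by simp only [hinv u hu]

lemma rpow_smul_integral_comp_mul_rpow {a : ℝ} (ha : 0 < a) {f : ℝ → E} (hf : Continuous f)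
    {x : ℝ} (hx : 0 < x) :
    x ^ a • ∫ t in (0:ℝ)..1, f (x * t ^ (1 / a)) = ∫ u in (0:ℝ)..x, (a * u ^ (a - 1)) • f u := by
  rw [integral_comp_rpow_one_div (h := fun u => f (x * u)) ha (by fun_prop)]
  have hscale := intervalIntegral.smul_integral_comp_mul_left (a := 0) (b := 1)
    (fun u : ℝ => (a * u ^ (a - 1)) • f u) x
  rw [mul_zero, mul_one] at hscale
  rw [← hscale, ← intervalIntegral.integral_smul, ← intervalIntegral.integral_smul]
  refine intervalIntegral.integral_congr fun u hu => ?_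
  rw [uIcc_of_le zero_le_one] at hu
  simp only [smul_smul]
  rw [Real.mul_rpow hx.le hu.1, Real.rpow_sub_one hx.ne']
  congr 1
  field_simp

lemma hasDerivAt_integral_rpow_weight_smul [CompleteSpace E] {a : ℝ} (ha : 0 < a) {f : ℝ → E}
    (hf : Continuous f) {x : ℝ} (hx : 0 < x) :
    HasDerivAt (fun v => ∫ u in (0:ℝ)..v, (a * u ^ (a - 1)) • f u)
      ((a * x ^ (a - 1)) • f x) x := by
  have hmeas : StronglyMeasurable fun u : ℝ => (a * u ^ (a - 1)) • f u :=
    (by fun_prop : Measurable fun u : ℝ => a * u ^ (a - 1)).stronglyMeasurable.smul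
      hf.stronglyMeasurable
  exact intervalIntegral.integral_hasDerivAt_right
    (intervalIntegrable_rpow_weight_smul ha hf 0 x) hmeas.stronglyMeasurableAtFilter
    ((continuousAt_const.mul (Real.continuousAt_rpow_const _ _ (Or.inl hx.ne'))).smul
      hf.continuousAt)

/-- Composing two power-substitution averages of a continuous function. -/
lemma integral_integral_comp_rpow_mul_rpow [CompleteSpace E] {α β : ℝ} (hα : 0 < α)
    (hβ : 0 < β) (hαβ : α ≠ β) {f : ℝ → E} (hf : Continuous f) :
    (∫ s in (0:ℝ)..1, ∫ t in (0:ℝ)..1, f (s ^ (1 / β) * t ^ (1 / α))) =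
      (β / (β - α)) • (∫ u in (0:ℝ)..1, (α * u ^ (α - 1)) • f u)
        - (α / (β - α)) • (∫ u in (0:ℝ)..1, (β * u ^ (β - 1)) • f u) := by
  have hne : β - α ≠ 0 := sub_ne_zero.2 hαβ.symm
  set G : ℝ → E := fun x => ∫ t in (0:ℝ)..1, f (x * t ^ (1 / α))
  set F : ℝ → ℝ → E := fun a v => ∫ u in (0:ℝ)..v, (a * u ^ (a - 1)) • f u with hF
  have hpow : Continuous fun t : ℝ => t ^ (1 / α) :=
    Real.continuous_rpow_const (by positivity)
  have hGc : Continuous G :=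
    intervalIntegral.continuous_parametric_intervalIntegral_of_continuous'
      (f := fun x t : ℝ => f (x * t ^ (1 / α)))
      (hf.comp (continuous_fst.mul (hpow.comp continuous_snd))) 0 1
  have hFG : ∀ v, 0 < v → v ^ α • G v = F α v := fun v hv =>
    rpow_smul_integral_comp_mul_rpow hα hf hv
  have hGF : ∀ v, 0 < v → v ^ β • G v = v ^ (β - α) • F α v := fun v hv => by
    rw [← hFG v hv, smul_smul, ← Real.rpow_add hv, sub_add_cancel]
  have hFβc : Continuous (F β) :=
    intervalIntegral.continuous_primitive (intervalIntegrable_rpow_weight_smul hβ hf) 0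
  have hderiv : ∀ v ∈ Ioo (0:ℝ) 1,
      HasDerivAt (fun v => (β / (β - α)) • v ^ β • G v - (α / (β - α)) • F β v)
        ((β * v ^ (β - 1)) • G v) v := by
    intro v hv
    have hv0 : 0 < v := hv.1
    have h₁ := ((Real.hasDerivAt_rpow_const (p := β - α) (Or.inl hv0.ne')).smul
      (hasDerivAt_integral_rpow_weight_smul hα hf hv0)).const_smul (β / (β - α))
    have h₂ := (hasDerivAt_integral_rpow_weight_smul hβ hf hv0).const_smul (α / (β - α))
    refine ((h₁.sub h₂).congr_of_eventuallyEq ?_).congr_deriv ?_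
    · filter_upwards [lt_mem_nhds hv0] with w hw
      simp only [hGF w hw]
      rfl
    · change _ • (_ + _ • F α v) - _ = _
      rw [← hFG v hv0]
      have e₁ : v ^ (β - 1) = v ^ (β - α) * v ^ (α - 1) := by
        rw [← Real.rpow_add hv0]; ring_nf
      have e₂ : v ^ (β - 1) = v ^ (β - α - 1) * v ^ α := by
        rw [← Real.rpow_add hv0]; ring_nf
      have e₃ : β / (β - α) * (v ^ (β - α) * (α * v ^ (α - 1))) =
          α / (β - α) * (β * v ^ (β - 1)) := by
        rw [e₁]; ring
      have e₄ : β / (β - α) * ((β - α) * v ^ (β - α - 1) * v ^ α) = β * v ^ (β - 1) := by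
        rw [e₂]; field_simp
      simp only [smul_add, smul_smul]
      rw [e₃, e₄]
      abel
  have hftc := intervalIntegral.integral_eq_sub_of_hasDerivAt_of_le zero_le_one
    (((((Real.continuous_rpow_const hβ.le).smul hGc).const_smul _).sub
      (hFβc.const_smul _)).continuousOn) hderiv
    (intervalIntegrable_rpow_weight_smul hβ hGc 0 1)
  calc _ = ∫ s in (0:ℝ)..1, G (s ^ (1 / β)) := rfl
    _ = _ := by
      rw [integral_comp_rpow_one_div hβ hGc, hftc]
      have h1 : G 1 = F α 1 := by simpa using hFG 1 one_pos
      simp [h1, hF, Real.zero_rpow hβ.ne']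

end PowerSubstitution

/-- Proposition 1, at the level of Lévy exponents: the Lévy exponent of
`𝒥^α(𝒥^β(ν))` equals that of the random integral with time change
`r_{(α,β)}(u) = (β/(β-α)) u^α - (α/(β-α)) u^β`, whose derivative is
`(β/(β-α)) α u^{α-1} - (α/(β-α)) β u^{β-1}`. -/
theorem composition_levy_exponent {d : ℕ} (α β : ℝ) (hα : 0 < α) (hβ : 0 < β)
    (hαβ : α ≠ β) (Φ : EuclideanSpace ℝ (Fin d) → ℂ) (hΦ : Continuous Φ)
    (y : EuclideanSpace ℝ (Fin d)) :
    (∫ s in (0:ℝ)..1, ∫ t in (0:ℝ)..1, Φ ((s ^ (1/β) * t ^ (1/α)) • y)) =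
      (β / (β - α)) • (∫ u in (0:ℝ)..1, (α * u ^ (α - 1)) • Φ (u • y))
        - (α / (β - α)) • (∫ u in (0:ℝ)..1, (β * u ^ (β - 1)) • Φ (u • y)) := by
  exact integral_integral_comp_rpow_mul_rpow hα hβ hαβ (f := fun u => Φ (u • y))
    (by fun_prop)
end

section
/- Let 0 < α < β, let Φ : ℝ^d → ℂ be continuous, and fix y ∈ ℝ^d. Then (β−α) ∫₀¹ ∫₀¹ Φ(s^{1/β} t^{1/α} y) dt ds = β ∫₀¹ Φ(t^{1/α} y) dt − α ∫₀¹ Φ(t^{1/β} y) dt. (Corollary 1, formula (5): (β−α)·log(𝒥^α(𝒥^β(ν)))^(y) = β·log(𝒥^α(ν))^(y) − α·log(𝒥^β(ν))^(y) at the level of Lévy exponents.) -/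
open MeasureTheory

/-- The substitution `u = s ^ (α / β) * t` in the inner integral. -/
lemma rpow_mul_integral_comp_rpow_mul {E : Type*} [NormedAddCommGroup E] [NormedSpace ℝ E]
    {α β : ℝ} (hα : 0 < α) (g : ℝ → E) {s : ℝ} (hs : 0 ≤ s) :
    (s ^ (α / β)) • (∫ t in (0:ℝ)..1, g (s ^ (1/β) * t ^ (1/α))) =
      ∫ t in (0:ℝ)..s ^ (α / β), g (t ^ (1/α)) := by
  have h : ∀ t ∈ Set.uIcc (0:ℝ) 1,
      g (s ^ (1/β) * t ^ (1/α)) = g ((s ^ (α / β) * t) ^ (1/α)) := by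
    intro t ht
    rw [Set.uIcc_of_le zero_le_one] at ht
    rw [Real.mul_rpow (by positivity) ht.1, ← Real.rpow_mul hs]
    congr 4
    field_simp
  rw [intervalIntegral.integral_congr h,
    intervalIntegral.smul_integral_comp_mul_left (fun u => g (u ^ (1/α)))]
  simp

lemma smul_integral_integral_comp_rpow_mul {E : Type*} [NormedAddCommGroup E] [NormedSpace ℝ E]
    [CompleteSpace E] {α β : ℝ} (hα : 0 < α) (hαβ : α < β) {g : ℝ → E} (hg : Continuous g) :
    (β - α) • (∫ s in (0:ℝ)..1, ∫ t in (0:ℝ)..1, g (s ^ (1/β) * t ^ (1/α))) =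
      β • (∫ t in (0:ℝ)..1, g (t ^ (1/α))) - α • (∫ t in (0:ℝ)..1, g (t ^ (1/β))) := by
  have hβ : 0 < β := hα.trans hαβ
  have hγ : 0 < 1 - α / β := by
    rw [sub_pos, div_lt_one hβ]; exact hαβ
  have hcα : Continuous fun t : ℝ => t ^ (1/α) := Real.continuous_rpow_const (by positivity)
  have hcβ : Continuous fun t : ℝ => t ^ (1/β) := Real.continuous_rpow_const (by positivity)
  have hcγ : Continuous fun t : ℝ => t ^ (α/β) := Real.continuous_rpow_const (by positivity)
  have hcγ' : Continuous fun t : ℝ => t ^ (1 - α/β) := Real.continuous_rpow_const hγ.le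
  have hgα : Continuous fun t : ℝ => g (t ^ (1/α)) := hg.comp hcα
  have hgβ : Continuous fun t : ℝ => g (t ^ (1/β)) := hg.comp hcβ
  have hI : Continuous fun s : ℝ => ∫ t in (0:ℝ)..1, g (s ^ (1/β) * t ^ (1/α)) := by
    apply intervalIntegral.continuous_parametric_intervalIntegral_of_continuous'
    exact hg.comp ((hcβ.comp continuous_fst).mul (hcα.comp continuous_snd))
  have hF : ∀ x : ℝ, HasDerivAt (fun x => ∫ t in (0:ℝ)..x, g (t ^ (1/α))) (g (x ^ (1/α))) x :=
    fun x => hgα.integral_hasStrictDerivAt 0 x |>.hasDerivAt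
  have hFc : Continuous fun x : ℝ => ∫ t in (0:ℝ)..x, g (t ^ (1/α)) :=
    continuous_iff_continuousAt.2 fun x => (hF x).continuousAt
  have hI' : Continuous fun s : ℝ =>
      (1 - α/β) • (∫ t in (0:ℝ)..1, g (s ^ (1/β) * t ^ (1/α))) := hI.const_smul _
  have hgβ' : Continuous fun s : ℝ => (α/β) • g (s ^ (1/β)) := hgβ.const_smul _
  have key := intervalIntegral.integral_eq_sub_of_hasDerivAt_of_le
    (f := fun s : ℝ => s ^ (1 - α/β) • ∫ t in (0:ℝ)..s ^ (α/β), g (t ^ (1/α)))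
    (f' := fun s : ℝ => (1 - α/β) • (∫ t in (0:ℝ)..1, g (s ^ (1/β) * t ^ (1/α)))
      + (α/β) • g (s ^ (1/β)))
    zero_le_one (hcγ'.smul (hFc.comp hcγ)).continuousOn ?_
    ((hI'.add hgβ').intervalIntegrable 0 1)
  · rw [intervalIntegral.integral_add (hI'.intervalIntegrable 0 1)
      (hgβ'.intervalIntegrable 0 1), intervalIntegral.integral_smul,
      intervalIntegral.integral_smul, Real.zero_rpow hγ.ne', Real.one_rpow, Real.one_rpow,
      one_smul, zero_smul, sub_zero] at key
    rw [← key, smul_add, smul_smul, smul_smul, mul_sub, mul_one, mul_div_cancel₀ _ hβ.ne',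
      add_sub_cancel_right]
  · intro s hs
    have hs0 : 0 < s := hs.1
    have h1 := Real.hasDerivAt_rpow_const (x := s) (p := 1 - α/β) (Or.inl hs0.ne')
    have h2 := Real.hasDerivAt_rpow_const (x := s) (p := α/β) (Or.inl hs0.ne')
    refine (h1.smul ((hF _).scomp s h2)).congr_deriv ?_
    simp only [Function.comp_apply]
    rw [← rpow_mul_integral_comp_rpow_mul hα g hs0.le, smul_smul, smul_smul, ← Real.rpow_mul hs0.le,
      add_comm]
    congr 2
    · rw [mul_assoc, ← Real.rpow_add hs0]
      simp
    · rw [mul_left_comm, ← Real.rpow_add hs0]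
      simp
    · congr 2
      field_simp

/-- Corollary 1, formula (5), at the level of Lévy exponents:
`(β-α)·log(𝒥^α(𝒥^β(ν)))^(y) = β·log(𝒥^α(ν))^(y) - α·log(𝒥^β(ν))^(y)`. -/
theorem corollary_one_levy_exponent {d : ℕ} (α β : ℝ) (hα : 0 < α) (hαβ : α < β)
    (Φ : EuclideanSpace ℝ (Fin d) → ℂ) (hΦ : Continuous Φ)
    (y : EuclideanSpace ℝ (Fin d)) :
    (β - α) • (∫ s in (0:ℝ)..1, ∫ t in (0:ℝ)..1, Φ ((s ^ (1/β) * t ^ (1/α)) • y)) =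
      β • (∫ t in (0:ℝ)..1, Φ ((t ^ (1/α)) • y))
        - α • (∫ t in (0:ℝ)..1, Φ ((t ^ (1/β)) • y)) :=
  smul_integral_integral_comp_rpow_mul hα hαβ
    (g := fun r => Φ (r • y)) (hΦ.comp (continuous_id.smul continuous_const))
end

section
/- Let 0 < α < β, let Φ : ℝ^d → ℂ be continuous, and fix y ∈ ℝ^d. Then (1 − α/β) ∫₀¹ ∫₀¹ Φ(t^{1/α} s^{1/β} y) dt ds + (α/β) ∫₀¹ Φ(s^{1/β} y) ds = ∫₀¹ Φ(t^{1/α} y) dt. (This is the convolution factorization identity 𝒥^β(𝒥^α(ν^{*(1−α/β)}) * ν^{*α/β}) = 𝒥^α(ν) of Corollary 1/formula (23), expressed at the level of Lévy exponents.) -/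
open MeasureTheory

/-- The fundamental theorem of calculus for `s ↦ s ^ (1 - c) • ∫ u in 0..s ^ c, f u` on `[0, 1]`. -/
theorem integral_rpow_scaling_add {E : Type*} [NormedAddCommGroup E] [NormedSpace ℝ E]
    [CompleteSpace E] {f : ℝ → E} (hf : Continuous f) {c : ℝ} (hc0 : 0 < c) (hc1 : c < 1) :
    (1 - c) • (∫ s in (0:ℝ)..1, ∫ t in (0:ℝ)..1, f (t * s ^ c))
      + c • (∫ s in (0:ℝ)..1, f (s ^ c)) = ∫ t in (0:ℝ)..1, f t := by
  have hpow : Continuous fun s : ℝ => s ^ c := Real.continuous_rpow_const hc0.le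
  have hpow' : Continuous fun s : ℝ => s ^ (1 - c) := Real.continuous_rpow_const (by linarith)
  have hinner : Continuous fun s : ℝ => ∫ t in (0:ℝ)..1, f (t * s ^ c) :=
    intervalIntegral.continuous_parametric_intervalIntegral_of_continuous'
      (by simp only [Function.uncurry_def]; fun_prop) 0 1
  have hinner_smul : Continuous fun s : ℝ => (1 - c) • ∫ t in (0:ℝ)..1, f (t * s ^ c) :=
    hinner.const_smul (1 - c)
  have hcomp_smul : Continuous fun s : ℝ => c • f (s ^ c) := (hf.comp hpow).const_smul c
  have hprim : Continuous fun x : ℝ => ∫ u in (0:ℝ)..x, f u :=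
    intervalIntegral.continuous_primitive (fun a b => hf.intervalIntegrable a b) 0
  have hderiv : ∀ s ∈ Set.Ioo (0:ℝ) 1,
      HasDerivAt (fun s : ℝ => s ^ (1 - c) • ∫ u in (0:ℝ)..s ^ c, f u)
        ((1 - c) • (∫ t in (0:ℝ)..1, f (t * s ^ c)) + c • f (s ^ c)) s := by
    intro s hs
    have hs0 : 0 < s := hs.1
    have hF : HasDerivAt (fun x : ℝ => ∫ u in (0:ℝ)..x, f u) (f (s ^ c)) (s ^ c) :=
      hf.integral_hasStrictDerivAt 0 (s ^ c) |>.hasDerivAt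
    have hcomp := hF.scomp s (Real.hasDerivAt_rpow_const (p := c) (Or.inl hs0.ne'))
    convert! (Real.hasDerivAt_rpow_const (p := 1 - c) (Or.inl hs0.ne')).smul hcomp using 1
    have hexp : s ^ (1 - c) * (c * s ^ (c - 1)) = c := by
      rw [mul_left_comm, ← Real.rpow_add hs0]
      simp
    have hexp' : (1 - c) * s ^ (1 - c - 1) * s ^ c = 1 - c := by
      rw [mul_assoc, ← Real.rpow_add hs0]
      simp
    have hscale : ∫ u in (0:ℝ)..s ^ c, f u = s ^ c • ∫ t in (0:ℝ)..1, f (t * s ^ c) := by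
      simp only [intervalIntegral.smul_integral_comp_mul_right, zero_mul, one_mul]
    rw [Function.comp_apply, hscale, smul_smul, smul_smul, hexp, hexp', add_comm]
  have hftc := intervalIntegral.integral_eq_sub_of_hasDerivAt_of_le zero_le_one
    (hpow'.smul (hprim.comp hpow)).continuousOn hderiv
    ((hinner_smul.add hcomp_smul).intervalIntegrable 0 1)
  rw [← intervalIntegral.integral_smul, ← intervalIntegral.integral_smul,
    ← intervalIntegral.integral_add (hinner_smul.intervalIntegrable 0 1)
      (hcomp_smul.intervalIntegrable 0 1)]
  simpa [Real.zero_rpow hc0.ne', Real.zero_rpow (sub_pos.2 hc1).ne'] using hftc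

/-- The convolution factorization identity
`𝒥^β(𝒥^α(ν^{*(1-α/β)}) * ν^{*α/β}) = 𝒥^α(ν)` (formula (23)),
expressed at the level of Lévy exponents. -/
theorem factorization_levy_exponent {d : ℕ} (α β : ℝ) (hα : 0 < α) (hαβ : α < β)
    (Φ : EuclideanSpace ℝ (Fin d) → ℂ) (hΦ : Continuous Φ)
    (y : EuclideanSpace ℝ (Fin d)) :
    (1 - α / β) • (∫ t in (0:ℝ)..1, ∫ s in (0:ℝ)..1, Φ ((t ^ (1/α) * s ^ (1/β)) • y))
        + (α / β) • (∫ s in (0:ℝ)..1, Φ ((s ^ (1/β)) • y)) =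
      ∫ t in (0:ℝ)..1, Φ ((t ^ (1/α)) • y) := by
  have hβ : 0 < β := hα.trans hαβ
  have hf : Continuous fun u : ℝ => Φ ((u ^ (1 / α)) • y) :=
    hΦ.comp ((Real.continuous_rpow_const (one_div_pos.2 hα).le).smul continuous_const)
  have hpow : ∀ s ∈ Set.uIcc (0:ℝ) 1, (s ^ (α / β)) ^ (1 / α) = s ^ (1 / β) := by
    intro s hs
    rw [Set.uIcc_of_le zero_le_one] at hs
    rw [← Real.rpow_mul hs.1]
    congr 1
    field_simp
  have hcont : Continuous fun p : ℝ × ℝ => Φ ((p.1 ^ (1 / α) * p.2 ^ (1 / β)) • y) := by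
    have h₁ := Real.continuous_rpow_const (one_div_pos.2 hα).le
    have h₂ := Real.continuous_rpow_const (one_div_pos.2 hβ).le
    exact hΦ.comp (((h₁.comp continuous_fst).mul (h₂.comp continuous_snd)).smul continuous_const)
  rw [MeasureTheory.intervalIntegral_intervalIntegral_swap,
    ← integral_rpow_scaling_add hf (div_pos hα hβ) ((div_lt_one hβ).2 hαβ)]
  · congr 2
    · refine intervalIntegral.integral_congr fun s hs => intervalIntegral.integral_congr fun t ht => ?_
      rw [Set.uIcc_of_le zero_le_one] at ht
      have hs' : 0 ≤ s := by
        rw [Set.uIcc_of_le zero_le_one] at hs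
        exact hs.1
      simp only [Real.mul_rpow ht.1 (Real.rpow_nonneg hs' _), hpow s hs]
    · refine intervalIntegral.integral_congr fun s hs => ?_
      simp only [hpow s hs]
  · exact (hcont.continuousOn.integrableOn_compact
      (isCompact_uIcc.prod isCompact_uIcc)).mono_set
      (Set.prod_mono Set.uIoc_subset_uIcc Set.uIoc_subset_uIcc)
end

section
/- Let β > 0, let Φ : ℝ^d → ℂ be continuous, and fix y ∈ ℝ^d. Then ∫₀¹ ∫₀¹ Φ(s^{1/β} t^{1/β} y) dt ds = ∫₀¹ Φ(u y)·β² u^{β−1}(−log u) du, the integrand on the right being Φ(u y) times the derivative of the time change r_{(β,β)}(u) := u^β(1 − β log u). (Proposition 2 at the level of Lévy exponents: 𝒥^β(𝒥^β(ν)) = L(∫₀¹ t dY_ν(r_{(β,β)}(t))).) -/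
open MeasureTheory

/-- Averaging a continuous function over products of two points of the unit interval amounts to
integrating it against the density `-log v`. -/
theorem integral_integral_mul_eq_integral_neg_log_smul {E : Type*} [NormedAddCommGroup E]
    [NormedSpace ℝ E] [CompleteSpace E] {G : ℝ → E} (hG : Continuous G) :
    (∫ s in (0:ℝ)..1, ∫ t in (0:ℝ)..1, G (s * t)) =
      ∫ v in (0:ℝ)..1, (-Real.log v) • G v := by
  set h : ℝ → E := fun s => ∫ t in (0:ℝ)..1, G (s * t) with h_def
  have hh : Continuous h :=
    intervalIntegral.continuous_parametric_intervalIntegral_of_continuous' (by fun_prop) 0 1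
  have primitive_eq (s : ℝ) : s • h s = ∫ v in (0:ℝ)..s, G v := by
    simp [h_def]
  have h_log : IntervalIntegrable (fun s => Real.log s • G s) volume 0 1 :=
    intervalIntegral.intervalIntegrable_log'.smul_continuousOn hG.continuousOn
  have h_cont : Continuous fun s => (s * Real.log s) • h s := Real.continuous_mul_log.smul hh
  have h_deriv : ∀ s ∈ Set.Ioo (0:ℝ) 1,
      HasDerivAt (fun s => (s * Real.log s) • h s) (Real.log s • G s + h s) s := by
    intro s hs
    have hs0 : s ≠ 0 := hs.1.ne'
    have hd := (Real.hasDerivAt_log hs0).smul (hG.integral_hasStrictDerivAt 0 s).hasDerivAt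
    rw [← primitive_eq, smul_smul, inv_mul_cancel₀ hs0, one_smul] at hd
    refine hd.congr_of_eventuallyEq (.of_forall fun x => ?_)
    simp only [Pi.smul_apply', ← primitive_eq, smul_smul, mul_comm]
  have key := intervalIntegral.integral_eq_sub_of_hasDerivAt_of_le zero_le_one
    h_cont.continuousOn h_deriv (h_log.add (hh.intervalIntegrable 0 1))
  rw [intervalIntegral.integral_add h_log (hh.intervalIntegrable 0 1)] at key
  simp only [Real.log_one, mul_zero, zero_mul, zero_smul, sub_zero] at key
  simp only [neg_smul, intervalIntegral.integral_neg]
  exact eq_neg_of_add_eq_zero_right key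

/-- The substitution `v = u ^ β` on the unit interval, without any regularity assumption. -/
theorem integral_zero_one_comp_rpow {E : Type*} [NormedAddCommGroup E] [NormedSpace ℝ E]
    (g : ℝ → E) {β : ℝ} (hβ : 0 < β) :
    (∫ u in (0:ℝ)..1, (β * u ^ (β - 1)) • g (u ^ β)) = ∫ v in (0:ℝ)..1, g v := by
  have key := integral_comp_rpow_Ioi_of_pos (g := (Set.Iic (1:ℝ)).indicator g) hβ
  rw [setIntegral_indicator measurableSet_Iic, Set.Ioi_inter_Iic] at key
  rw [intervalIntegral.integral_of_le zero_le_one, intervalIntegral.integral_of_le zero_le_one,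
    ← key, ← Set.Ioi_inter_Iic, ← setIntegral_indicator measurableSet_Iic]
  refine setIntegral_congr_fun measurableSet_Ioi fun u (hu : 0 < u) => ?_
  have h_iff : u ^ β ≤ 1 ↔ u ≤ 1 := by
    simpa using Real.rpow_le_rpow_iff hu.le zero_le_one hβ
  by_cases h : u ≤ 1 <;> simp [Set.indicator, h_iff, h]

/-- Proposition 2, at the level of Lévy exponents: the Lévy exponent of
`𝒥^β(𝒥^β(ν))` equals that of the random integral with time change
`r_{(β,β)}(u) = u^β(1 - β log u)`, whose derivative is `β² u^{β-1}(-log u)`. -/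
theorem composition_equal_indices_levy_exponent {d : ℕ} (β : ℝ) (hβ : 0 < β)
    (Φ : EuclideanSpace ℝ (Fin d) → ℂ) (hΦ : Continuous Φ)
    (y : EuclideanSpace ℝ (Fin d)) :
    (∫ s in (0:ℝ)..1, ∫ t in (0:ℝ)..1, Φ ((s ^ (1/β) * t ^ (1/β)) • y)) =
      ∫ u in (0:ℝ)..1, (β ^ 2 * u ^ (β - 1) * (-Real.log u)) • Φ (u • y) := by
  have hG : Continuous fun v : ℝ => Φ (v ^ (1/β) • y) :=
    hΦ.comp ((Real.continuous_rpow_const (one_div_pos.2 hβ).le).smul continuous_const)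
  calc
    _ = ∫ s in (0:ℝ)..1, ∫ t in (0:ℝ)..1, Φ ((s * t) ^ (1/β) • y) := by
      refine intervalIntegral.integral_congr fun s hs => ?_
      refine intervalIntegral.integral_congr fun t ht => ?_
      rw [Set.uIcc_of_le zero_le_one] at hs ht
      simp only [Real.mul_rpow hs.1 ht.1]
    _ = ∫ v in (0:ℝ)..1, (-Real.log v) • Φ (v ^ (1/β) • y) :=
      integral_integral_mul_eq_integral_neg_log_smul hG
    _ = ∫ u in (0:ℝ)..1,
        (β * u ^ (β - 1)) • (-Real.log (u ^ β)) • Φ ((u ^ β) ^ (1/β) • y) :=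
      (integral_zero_one_comp_rpow (fun v => (-Real.log v) • Φ (v ^ (1/β) • y)) hβ).symm
    _ = _ := by
      rw [intervalIntegral.integral_of_le zero_le_one, intervalIntegral.integral_of_le zero_le_one]
      refine setIntegral_congr_fun measurableSet_Ioc fun u hu => ?_
      simp only [one_div, Real.rpow_rpow_inv hu.1.le hβ.ne', Real.log_rpow hu.1, smul_smul]
      congr 1
      ring
end

section
/- Let α, β be positive reals with α ≠ β, and let M be a σ-finite Borel measure on ℝ^d with M({0}) = 0 and M({x : ‖x‖ > 1}) < ∞. Then M^{(β)}({x : ‖x‖ > 1}) < ∞ and b_{M^{(β)},α} = (β/(β−α)) (b_{M,α} − b_{M,β}). (Intermediate claim proved in Proposition 3.) -/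
open MeasureTheory

/-- The measure `M^{(β)}`, the Lévy measure of `𝒥^β(μ)` when `μ` has Lévy
measure `M`: `M^{(β)}(A) = ∫₀¹ ∫ 1_A(t^{1/β} x) M(dx) dt`. -/
noncomputable def levyMeasureJ {d : ℕ} (M : Measure (EuclideanSpace ℝ (Fin d)))
    (β : ℝ) : Measure (EuclideanSpace ℝ (Fin d)) :=
  (volume.restrict (Set.Ioc (0:ℝ) 1)).bind fun t =>
    M.map fun x => (t ^ (1/β)) • x

/-- The integrand of `b_{N,γ}` has norm `‖x‖ ^ (-γ) ≤ 1` on `{‖x‖ > 1}`. -/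
lemma integrableOn_rpow_norm_smul {E : Type*} [NormedAddCommGroup E] [NormedSpace ℝ E]
    [MeasurableSpace E] [BorelSpace E] [SecondCountableTopology E] {γ : ℝ} (hγ : 0 < γ)
    {N : Measure E} (hN : N {x | 1 < ‖x‖} < ⊤) :
    IntegrableOn (fun x => (‖x‖ ^ (-1 - γ)) • x) {x | 1 < ‖x‖} N := by
  have hS : MeasurableSet {x : E | 1 < ‖x‖} := measurableSet_lt measurable_const measurable_norm
  refine Measure.integrableOn_of_bounded (M := 1) hN.ne
    (by fun_prop : Measurable fun x : E => (‖x‖ ^ (-1 - γ)) • x).aestronglyMeasurable ?_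
  refine (ae_restrict_iff' hS).2 (.of_forall fun x (hx : 1 < ‖x‖) => ?_)
  have hx0 : 0 < ‖x‖ := one_pos.trans hx
  rw [norm_smul, Real.norm_of_nonneg (by positivity), ← Real.rpow_add_one hx0.ne']
  exact Real.rpow_le_one_of_one_le_of_nonpos hx.le (by linarith)

/-- `M^{(β)}` is the image of `dt ⊗ M` on `(0, 1] × ℝ^d` under `(t, x) ↦ t^{1/β} x`. -/
lemma levyMeasureJ_eq_map_prod {d : ℕ} (M : Measure (EuclideanSpace ℝ (Fin d))) [SFinite M]
    (β : ℝ) :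
    levyMeasureJ M β = ((volume.restrict (Set.Ioc (0 : ℝ) 1)).prod M).map
      fun p => (p.1 ^ (1 / β)) • p.2 := by
  have hφ : Measurable fun p : ℝ × EuclideanSpace ℝ (Fin d) => (p.1 ^ (1 / β)) • p.2 := by
    fun_prop
  have hφt (t : ℝ) : Measurable fun x : EuclideanSpace ℝ (Fin d) => (t ^ (1 / β)) • x := by
    fun_prop
  have hk : Measurable fun t : ℝ => M.map fun x => (t ^ (1 / β)) • x := by
    refine Measure.measurable_of_measurable_coe _ fun A hA => ?_
    simp_rw [Measure.map_apply (hφt _) hA]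
    exact measurable_measure_prodMk_left (hφ hA)
  ext A hA
  rw [levyMeasureJ, Measure.bind_apply hA hk.aemeasurable, Measure.map_apply hφ hA,
    Measure.prod_apply (hφ hA)]
  simp_rw [Measure.map_apply (hφt _) hA]
  rfl

lemma norm_rpow_smul_of_pos {E : Type*} [NormedAddCommGroup E] [NormedSpace ℝ E] {t : ℝ}
    (ht : 0 < t) (p : ℝ) (x : E) : ‖(t ^ p) • x‖ = t ^ p * ‖x‖ := by
  rw [norm_smul, Real.norm_of_nonneg (by positivity)]

lemma one_lt_norm_of_one_lt_norm_rpow_smul {E : Type*} [NormedAddCommGroup E] [NormedSpace ℝ E]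
    {β t : ℝ} (hβ : 0 < β) (ht : t ∈ Set.Ioc (0 : ℝ) 1) {x : E}
    (h : 1 < ‖(t ^ (1 / β)) • x‖) : 1 < ‖x‖ := by
  rw [norm_rpow_smul_of_pos ht.1] at h
  exact h.trans_le (mul_le_of_le_one_left (norm_nonneg x)
    (Real.rpow_le_one ht.1.le ht.2 (by positivity)))

lemma one_lt_norm_rpow_smul_iff {E : Type*} [NormedAddCommGroup E] [NormedSpace ℝ E]
    {β t : ℝ} (hβ : 0 < β) (ht : 0 < t) {x : E} (hx : 0 < ‖x‖) :
    1 < ‖(t ^ (1 / β)) • x‖ ↔ ‖x‖ ^ (-β) < t := by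
  rw [norm_rpow_smul_of_pos ht, Real.rpow_neg hx.le, inv_lt_iff_one_lt_mul₀ (by positivity),
    ← Real.rpow_lt_rpow_iff zero_le_one (by positivity) hβ, Real.one_rpow,
    Real.mul_rpow (by positivity) hx.le, ← Real.rpow_mul ht.le, one_div_mul_cancel hβ.ne',
    Real.rpow_one]

lemma levyMeasureJ_lt_top {d : ℕ} {β : ℝ} (hβ : 0 < β)
    {M : Measure (EuclideanSpace ℝ (Fin d))} [SFinite M] (hM : M {x | 1 < ‖x‖} < ⊤) :
    levyMeasureJ M β {x | 1 < ‖x‖} < ⊤ := by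
  have hS : MeasurableSet {x : EuclideanSpace ℝ (Fin d) | 1 < ‖x‖} :=
    measurableSet_lt measurable_const measurable_norm
  rw [levyMeasureJ_eq_map_prod, Measure.map_apply (by fun_prop) hS]
  calc _ ≤ ((volume.restrict (Set.Ioc (0 : ℝ) 1)).prod M) (Set.univ ×ˢ {x | 1 < ‖x‖}) := by
        refine measure_mono_ae ?_
        filter_upwards [Measure.quasiMeasurePreserving_fst.ae (ae_restrict_mem measurableSet_Ioc)]
          with p hp h
        exact ⟨trivial, one_lt_norm_of_one_lt_norm_rpow_smul hβ hp h⟩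
    _ < ⊤ := by simpa [Measure.prod_prod] using hM

lemma integral_Ioc_indicator_rpow_smul {E : Type*} [NormedAddCommGroup E] [NormedSpace ℝ E]
    [CompleteSpace E] {α β : ℝ} (hβ : 0 < β) (hαβ : α ≠ β) {x : E} (hx : 1 < ‖x‖) :
    ∫ t in Set.Ioc (0 : ℝ) 1, Set.indicator {y : E | 1 < ‖y‖} (fun y => (‖y‖ ^ (-1 - α)) • y)
      ((t ^ (1 / β)) • x) =
      (β / (β - α)) • ((‖x‖ ^ (-1 - α)) • x - (‖x‖ ^ (-1 - β)) • x) := by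
  have hx0 : 0 < ‖x‖ := one_pos.trans hx
  have hr0 : 0 < ‖x‖ ^ (-β) := by positivity
  have hr1 : ‖x‖ ^ (-β) ≤ 1 := Real.rpow_le_one_of_one_le_of_nonpos hx.le (by linarith)
  have hsub : β - α ≠ 0 := sub_ne_zero.2 hαβ.symm
  have key : Set.EqOn (fun t : ℝ => Set.indicator {y : E | 1 < ‖y‖}
        (fun y => (‖y‖ ^ (-1 - α)) • y) ((t ^ (1 / β)) • x))
      (Set.indicator (Set.Ioi (‖x‖ ^ (-β))) fun t => (t ^ (-α / β)) • (‖x‖ ^ (-1 - α)) • x)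
      (Set.Ioc 0 1) := by
    intro t ht
    have ht0 : 0 < t := ht.1
    simp only [Set.indicator_apply, Set.mem_ofPred_eq, Set.mem_Ioi,
      one_lt_norm_rpow_smul_iff hβ ht0 hx0]
    congr 1
    rw [norm_rpow_smul_of_pos ht0, Real.mul_rpow (by positivity) hx0.le, ← Real.rpow_mul ht0.le,
      smul_smul, smul_smul, mul_right_comm, ← Real.rpow_add ht0]
    congr 3
    field_simp
    ring
  have hIoc : Set.Ioc (0 : ℝ) 1 ∩ Set.Ioi (‖x‖ ^ (-β)) = Set.Ioc (‖x‖ ^ (-β)) 1 := by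
    ext t
    simp only [Set.mem_inter_iff, Set.mem_Ioc, Set.mem_Ioi]
    exact ⟨fun h => ⟨h.2, h.1.2⟩, fun h => ⟨⟨hr0.trans h.1, h.2⟩, h.1⟩⟩
  have hexp : -α / β + 1 = (β - α) / β := by field_simp; ring
  have h1 : -α / β ≠ -1 := fun h => div_ne_zero hsub hβ.ne' (by linarith)
  rw [setIntegral_congr_fun measurableSet_Ioc key, setIntegral_indicator measurableSet_Ioi, hIoc,
    integral_smul_const, ← intervalIntegral.integral_of_le hr1,
    integral_rpow (Or.inr ⟨h1, Set.notMem_uIcc_of_lt hr0 one_pos⟩), ← sub_smul, smul_smul,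
    smul_smul, hexp, Real.one_rpow, ← Real.rpow_mul hx0.le]
  congr 1
  have h2 : ‖x‖ ^ (-1 - β) = ‖x‖ ^ (-β * ((β - α) / β)) * ‖x‖ ^ (-1 - α) := by
    rw [← Real.rpow_add hx0]
    congr 1
    field_simp
    ring
  rw [h2]
  field_simp

/-- Intermediate claim in the proof of Proposition 3: `M^{(β)}({‖x‖ > 1}) < ∞`
and `b_{M^{(β)},α} = (β/(β-α)) (b_{M,α} - b_{M,β})`. -/
theorem b_of_levyMeasureJ {d : ℕ} (α β : ℝ) (hα : 0 < α) (hβ : 0 < β) (hαβ : α ≠ β)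
    (M : Measure (EuclideanSpace ℝ (Fin d))) [SigmaFinite M]
    (h0 : M {0} = 0) (hfin : M {x | 1 < ‖x‖} < ⊤) :
    levyMeasureJ M β {x | 1 < ‖x‖} < ⊤ ∧
    (∫ x in {x : EuclideanSpace ℝ (Fin d) | 1 < ‖x‖},
        (‖x‖ ^ (-1 - α)) • x ∂(levyMeasureJ M β)) =
      (β / (β - α)) •
        ((∫ x in {x : EuclideanSpace ℝ (Fin d) | 1 < ‖x‖}, (‖x‖ ^ (-1 - α)) • x ∂M)
          - ∫ x in {x : EuclideanSpace ℝ (Fin d) | 1 < ‖x‖}, (‖x‖ ^ (-1 - β)) • x ∂M) := by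
  have hS : MeasurableSet {x : EuclideanSpace ℝ (Fin d) | 1 < ‖x‖} :=
    measurableSet_lt measurable_const measurable_norm
  have hJ := levyMeasureJ_lt_top hβ hfin
  refine ⟨hJ, ?_⟩
  have hint := (integrable_indicator_iff hS).2 (integrableOn_rpow_norm_smul hα hJ)
  rw [← integral_sub (integrableOn_rpow_norm_smul hα hfin) (integrableOn_rpow_norm_smul hβ hfin),
    ← integral_smul, ← integral_indicator hS, ← integral_indicator hS]
  have hφ : AEMeasurable (fun p : ℝ × EuclideanSpace ℝ (Fin d) => (p.1 ^ (1 / β)) • p.2)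
      ((volume.restrict (Set.Ioc (0 : ℝ) 1)).prod M) := by fun_prop
  rw [levyMeasureJ_eq_map_prod] at hint ⊢
  refine (integral_map hφ hint.aestronglyMeasurable).trans
    ((integral_prod_symm _ (hint.comp_aemeasurable hφ)).trans ?_)
  congr 1 with x : 1
  by_cases hx : 1 < ‖x‖
  · rw [Set.indicator_of_mem (show x ∈ {x : EuclideanSpace ℝ (Fin d) | 1 < ‖x‖} from hx)]
    exact integral_Ioc_indicator_rpow_smul hβ hαβ hx
  · rw [Set.indicator_of_notMem (show x ∉ {x : EuclideanSpace ℝ (Fin d) | 1 < ‖x‖} from hx)]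
    exact setIntegral_eq_zero_of_forall_eq_zero fun t ht => Set.indicator_of_notMem
      (show (t ^ (1 / β)) • x ∉ {y : EuclideanSpace ℝ (Fin d) | 1 < ‖y‖} from
        fun h => hx (one_lt_norm_of_one_lt_norm_rpow_smul hβ ht h)) _
end

section
/- Let 0 < α < β and let M be a σ-finite Borel measure on ℝ^d with M({0}) = 0. Define M^{(α,β)}(A) := ∫₀¹ ∫₀¹ ∫_{ℝ^d} 1_A(t^{1/α} s^{1/β} x) M(dx) ds dt (equivalently, M^{(α,β)} = (M^{(α)})^{(β)}). Then for every Borel set A ⊆ ℝ^d with 0 ∉ A one has, as an identity in [0,∞]: (β−α)·M^{(α,β)}(A) + α·M^{(β)}(A) = β·M^{(α)}(A); i.e., M^{(α,β)} = (β/(β−α)) M^{(α)} − (α/(β−α)) M^{(β)}. (Proposition 3(iii).) -/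
open MeasureTheory

/-- The change of variables `w = u * s ^ (1 / β)` on the unit interval. -/
theorem lintegral_mul_rpow_inv {β u : ℝ} (hβ : 0 < β) (hu : 0 < u) (g : ℝ → ENNReal) :
    ∫⁻ s in Set.Ioc (0 : ℝ) 1, g (u * s ^ (1 / β)) =
      ∫⁻ w in Set.Ioc (0 : ℝ) u, ENNReal.ofReal (β * w ^ (β - 1) * u ^ (-β)) * g w := by
  have hinv : ∀ w, 0 < w → u * ((w / u) ^ β) ^ (1 / β) = w := fun w hw ↦ by
    rw [← Real.rpow_mul (by positivity), mul_one_div_cancel hβ.ne', Real.rpow_one]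
    field_simp
  have himage : (fun w : ℝ ↦ (w / u) ^ β) '' Set.Ioc 0 u = Set.Ioc 0 1 := by
    ext s
    constructor
    · rintro ⟨w, ⟨hw, hwu⟩, rfl⟩
      exact ⟨by positivity, Real.rpow_le_one (by positivity) ((div_le_one hu).2 hwu) hβ.le⟩
    · rintro ⟨hs, hs1⟩
      refine ⟨u * s ^ (1 / β), ⟨by positivity, ?_⟩, ?_⟩
      · exact mul_le_of_le_one_right hu.le (Real.rpow_le_one hs.le hs1 (by positivity))
      · simp only
        rw [mul_div_cancel_left₀ _ hu.ne', ← Real.rpow_mul hs.le, one_div_mul_cancel hβ.ne',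
          Real.rpow_one]
  have hderiv : ∀ w ∈ Set.Ioc (0 : ℝ) u, HasDerivWithinAt (fun w : ℝ ↦ (w / u) ^ β)
      (β * w ^ (β - 1) * u ^ (-β)) (Set.Ioc 0 u) w := by
    intro w hw
    have hw0 : 0 < w := hw.1
    have h := (((hasDerivAt_id' w).div_const u).rpow_const (p := β)
      (Or.inl (div_pos hw0 hu).ne')).hasDerivWithinAt (s := Set.Ioc 0 u)
    refine h.congr_deriv ?_
    rw [Real.div_rpow hw0.le hu.le, Real.rpow_sub_one hu.ne', Real.rpow_neg hu.le]
    field_simp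
  have hinj : Set.InjOn (fun w : ℝ ↦ (w / u) ^ β) (Set.Ioc 0 u) := by
    intro a ha b hb hab
    rw [← hinv a ha.1, ← hinv b hb.1]
    exact congrArg (fun x : ℝ ↦ u * x ^ (1 / β)) hab
  rw [← himage, lintegral_image_eq_lintegral_abs_deriv_mul measurableSet_Ioc hderiv hinj]
  refine setLIntegral_congr_fun measurableSet_Ioc fun w hw ↦ ?_
  have hw0 : 0 < w := hw.1
  rw [hinv w hw0, abs_of_nonneg (by positivity)]

/-- The `t`-integral over `w ^ α ≤ t ≤ 1` arising from the change of order of integration. -/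
theorem lintegral_rpow_neg_div {α β w : ℝ} (hα : 0 < α) (hαβ : α < β) (hw : 0 < w)
    (hw1 : w ≤ 1) :
    ∫⁻ t in Set.Icc (w ^ α) 1, ENNReal.ofReal (t ^ (-(β / α))) =
      ENNReal.ofReal (α * (w ^ (α - β) - 1) / (β - α)) := by
  have hwα : 0 < w ^ α := by positivity
  have hle : w ^ α ≤ 1 := Real.rpow_le_one hw.le hw1 hα.le
  have h0 : (0 : ℝ) ∉ Set.uIcc (w ^ α) 1 := by
    rw [Set.uIcc_of_le hle]
    exact fun h ↦ hwα.not_ge h.1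
  have hne : -(β / α) ≠ -1 := by
    have : 1 < β / α := (one_lt_div hα).2 hαβ
    linarith
  have hint : IntervalIntegrable (fun t : ℝ ↦ t ^ (-(β / α))) volume (w ^ α) 1 :=
    intervalIntegral.intervalIntegrable_rpow (Or.inr h0)
  rw [← setLIntegral_congr Ioc_ae_eq_Icc, ← ofReal_integral_eq_lintegral_ofReal
    ((intervalIntegrable_iff_integrableOn_Ioc_of_le hle).1 hint)
    ((ae_restrict_iff' measurableSet_Ioc).2 (.of_forall fun t ht ↦
      Real.rpow_nonneg (hwα.trans ht.1).le _)),
    ← intervalIntegral.integral_of_le hle, integral_rpow (Or.inr ⟨hne, h0⟩)]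
  congr 1
  have hexp : α * (-(β / α) + 1) = α - β := by field_simp; ring
  have hd : -(β / α) + 1 = (α - β) / α := by field_simp; ring
  have h1 : β - α ≠ 0 := by linarith
  have h2 : α - β ≠ 0 := by linarith
  rw [← Real.rpow_mul hw.le, hexp, Real.one_rpow, hd]
  field_simp
  ring

/-- The law of `t ^ (1 / α) * s ^ (1 / β)` for independent uniform `t`, `s`, as a density. -/
theorem lintegral_lintegral_rpow_mul_rpow {α β : ℝ} (hα : 0 < α) (hαβ : α < β)
    {g : ℝ → ENNReal} (hg : Measurable g) :
    ∫⁻ t in Set.Ioc (0 : ℝ) 1, ∫⁻ s in Set.Ioc (0 : ℝ) 1, g (t ^ (1 / α) * s ^ (1 / β)) =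
      ∫⁻ w in Set.Ioc (0 : ℝ) 1,
        ENNReal.ofReal (β * w ^ (β - 1) * (α * (w ^ (α - β) - 1) / (β - α))) * g w := by
  have hβ : 0 < β := hα.trans hαβ
  let S : Set (ℝ × ℝ) := {p | p.2 ≤ p.1 ^ (1 / α)}
  have hS : MeasurableSet S := measurableSet_le (by fun_prop) (by fun_prop)
  let F : ℝ × ℝ → ENNReal := S.indicator fun p ↦
    ENNReal.ofReal (β * p.2 ^ (β - 1)) * ENNReal.ofReal (p.1 ^ (-(β / α))) * g p.2
  have hF : Measurable F := Measurable.indicator (by fun_prop) hS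
  calc
    _ = ∫⁻ t in Set.Ioc (0 : ℝ) 1, ∫⁻ w in Set.Ioc (0 : ℝ) 1, F (t, w) := by
      refine setLIntegral_congr_fun measurableSet_Ioc fun t ht ↦ ?_
      have ht0 : 0 < t := ht.1
      have ht1 : t ^ (1 / α) ≤ 1 := Real.rpow_le_one ht0.le ht.2 (by positivity)
      rw [lintegral_mul_rpow_inv hβ (by positivity) g]
      have hset : Set.Ioc 0 (t ^ (1 / α)) = Set.Iic (t ^ (1 / α)) ∩ Set.Ioc 0 1 := by
        ext w
        simp only [Set.mem_Ioc, Set.mem_inter_iff, Set.mem_Iic]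
        exact ⟨fun h ↦ ⟨h.2, h.1, h.2.trans ht1⟩, fun h ↦ ⟨h.2.1, h.1⟩⟩
      rw [hset, ← setLIntegral_indicator measurableSet_Iic]
      refine setLIntegral_congr_fun measurableSet_Ioc fun w hw ↦ ?_
      have hw0 : 0 < w := hw.1
      simp only [F, S, Set.indicator_apply, Set.mem_Iic, Set.mem_ofPred_eq]
      rw [← Real.rpow_mul ht0.le, ENNReal.ofReal_mul (by positivity),
        show 1 / α * -β = -(β / α) by ring]
    _ = ∫⁻ w in Set.Ioc (0 : ℝ) 1, ∫⁻ t in Set.Ioc (0 : ℝ) 1, F (t, w) :=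
      lintegral_lintegral_swap hF.aemeasurable
    _ = _ := by
      refine setLIntegral_congr_fun measurableSet_Ioc fun w hw ↦ ?_
      have hw0 : 0 < w := hw.1
      have hwα : 0 < w ^ α := by positivity
      rw [ENNReal.ofReal_mul (by positivity), ← lintegral_rpow_neg_div hα hαβ hw0 hw.2,
        mul_right_comm, ← lintegral_const_mul _ (by fun_prop)]
      have hset : Set.Icc (w ^ α) 1 = Set.Ici (w ^ α) ∩ Set.Ioc 0 1 := by
        ext t
        simp only [Set.mem_Ioc, Set.mem_inter_iff, Set.mem_Ici, Set.mem_Icc]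
        exact ⟨fun h ↦ ⟨h.1, hwα.trans_le h.1, h.2⟩, fun h ↦ ⟨h.1, h.2.2⟩⟩
      rw [hset, ← setLIntegral_indicator measurableSet_Ici]
      refine setLIntegral_congr_fun measurableSet_Ioc fun t ht ↦ ?_
      have hiff : w ≤ t ^ (1 / α) ↔ w ^ α ≤ t := by
        rw [one_div]
        exact Real.le_rpow_inv_iff_of_pos hw0.le ht.1.le hα
      simp only [F, S, Set.indicator_apply, Set.mem_Ici, Set.mem_ofPred_eq, hiff]
      rw [mul_right_comm]

/-- The composition identity for an arbitrary measurable integrand. -/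
theorem lintegral_rpow_composition {α β : ℝ} (hα : 0 < α) (hαβ : α < β)
    {g : ℝ → ENNReal} (hg : Measurable g) :
    ENNReal.ofReal (β - α) *
        (∫⁻ t in Set.Ioc (0 : ℝ) 1, ∫⁻ s in Set.Ioc (0 : ℝ) 1,
          g (t ^ (1 / α) * s ^ (1 / β))) +
      ENNReal.ofReal α * (∫⁻ t in Set.Ioc (0 : ℝ) 1, g (t ^ (1 / β))) =
      ENNReal.ofReal β * (∫⁻ t in Set.Ioc (0 : ℝ) 1, g (t ^ (1 / α))) := by
  have hβ : 0 < β := hα.trans hαβ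
  have hsub : 0 < β - α := sub_pos.2 hαβ
  have key : ∀ γ : ℝ, 0 < γ → ∫⁻ t in Set.Ioc (0 : ℝ) 1, g (t ^ (1 / γ)) =
      ∫⁻ w in Set.Ioc (0 : ℝ) 1, ENNReal.ofReal (γ * w ^ (γ - 1)) * g w := fun γ hγ ↦ by
    simpa using lintegral_mul_rpow_inv hγ one_pos g
  rw [lintegral_lintegral_rpow_mul_rpow hα hαβ hg, key α hα, key β hβ,
    ← lintegral_const_mul _ (by fun_prop), ← lintegral_const_mul _ (by fun_prop),
    ← lintegral_const_mul _ (by fun_prop), ← lintegral_add_left (by fun_prop)]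
  refine setLIntegral_congr_fun measurableSet_Ioc fun w hw ↦ ?_
  have hw0 : 0 < w := hw.1
  have hone : 1 ≤ w ^ (α - β) :=
    Real.one_le_rpow_of_pos_of_le_one_of_nonpos hw0 hw.2 (by linarith)
  have hnonneg : 0 ≤ β * w ^ (β - 1) * (α * (w ^ (α - β) - 1) / (β - α)) :=
    mul_nonneg (by positivity)
      (div_nonneg (mul_nonneg hα.le (sub_nonneg.2 hone)) hsub.le)
  rw [← mul_assoc, ← mul_assoc, ← mul_assoc, ← add_mul, ← ENNReal.ofReal_mul hsub.le,
    ← ENNReal.ofReal_mul hα.le, ← ENNReal.ofReal_mul hβ.le,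
    ← ENNReal.ofReal_add (mul_nonneg hsub.le hnonneg) (by positivity)]
  have hpow : w ^ (α - 1) = w ^ (β - 1) * w ^ (α - β) := by
    rw [← Real.rpow_add hw0]
    congr 1
    ring
  rw [hpow]
  congr 2
  field_simp
  ring

/-- Proposition 3(iii): with `M^{(β)}(A) = ∫₀¹ M({x : t^{1/β} x ∈ A}) dt` and
`M^{(α,β)}(A) = ∫₀¹∫₀¹ M({x : t^{1/α} s^{1/β} x ∈ A}) ds dt`, one has
`(β-α)·M^{(α,β)}(A) + α·M^{(β)}(A) = β·M^{(α)}(A)` in `[0,∞]`,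
i.e. `M^{(α,β)} = (β/(β-α)) M^{(α)} - (α/(β-α)) M^{(β)}`. -/
theorem levyMeasure_composition {d : ℕ} (α β : ℝ) (hα : 0 < α) (hαβ : α < β)
    (M : Measure (EuclideanSpace ℝ (Fin d))) [SigmaFinite M] (h0 : M {0} = 0)
    (A : Set (EuclideanSpace ℝ (Fin d))) (hA : MeasurableSet A) (h0A : 0 ∉ A) :
    ENNReal.ofReal (β - α) *
        (∫⁻ t in Set.Ioc (0:ℝ) 1, ∫⁻ s in Set.Ioc (0:ℝ) 1,
          M {x | (t ^ (1/α) * s ^ (1/β)) • x ∈ A}) +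
      ENNReal.ofReal α * (∫⁻ t in Set.Ioc (0:ℝ) 1, M {x | (t ^ (1/β)) • x ∈ A}) =
      ENNReal.ofReal β * (∫⁻ t in Set.Ioc (0:ℝ) 1, M {x | (t ^ (1/α)) • x ∈ A}) := by
  have hg : Measurable fun r : ℝ ↦ M {x | r • x ∈ A} :=
    measurable_measure_prodMk_left
      ((measurable_fst.smul measurable_snd : Measurable
        fun p : ℝ × EuclideanSpace ℝ (Fin d) ↦ p.1 • p.2) hA)
  exact lintegral_rpow_composition hα hαβ hg
end

section
/- Let α > 0, let Φ : ℝ^d → ℂ be continuous, and fix y ∈ ℝ^d. Then ∫₀¹ ∫₀¹ Φ(s^{1/(2α)} t^{1/α} y) dt ds = ∫₀¹ Φ((1 − √(1−t))^{1/α} y) dt = ∫₀¹ Φ((1 − √t)^{1/α} y) dt. (Example (a), formula (9): 𝒥^α(𝒥^{2α}(ν)) = L(∫₀¹ (1−√t)^{1/α} dY_ν(t)) at the level of Lévy exponents.) -/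
open MeasureTheory

theorem integral_comp_sqrt_unitInterval {E : Type*} [NormedAddCommGroup E] [NormedSpace ℝ E]
    {G : ℝ → E} (hG : Continuous G) :
    ∫ s in (0:ℝ)..1, G (√s) = ∫ u in (0:ℝ)..1, (2 * u) • G u := by
  have h := intervalIntegral.integral_deriv_smul_comp (a := 0) (b := 1)
    (f := fun u : ℝ => u ^ 2) (f' := fun u => 2 * u) (g := fun s => G (√s))
    (fun x _ => by simpa using hasDerivAt_pow 2 x) (by fun_prop) (by fun_prop)
  norm_num at h
  rw [← h]
  refine intervalIntegral.integral_congr fun u hu => ?_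
  rw [Set.uIcc_of_le zero_le_one] at hu
  simp [Real.sqrt_sq hu.1]

theorem integral_primitive_unitInterval {E : Type*} [NormedAddCommGroup E] [NormedSpace ℝ E]
    [CompleteSpace E] {F : ℝ → E} (hF : Continuous F) :
    ∫ u in (0:ℝ)..1, ∫ x in (0:ℝ)..u, F x = ∫ u in (0:ℝ)..1, (1 - u) • F u := by
  have h := intervalIntegral.integral_smul_deriv_eq_deriv_smul (a := 0) (b := 1)
    (u := fun x : ℝ => 1 - x) (u' := fun _ => -1)
    (v := fun u => ∫ x in (0:ℝ)..u, F x) (v' := F)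
    (fun x _ => by simpa using (hasDerivAt_id x).const_sub 1)
    (fun x _ => (hF.integral_hasStrictDerivAt 0 x).hasDerivAt)
    intervalIntegrable_const (hF.intervalIntegrable 0 1)
  simp [h]

theorem integral_integral_sqrt_mul_unitInterval {E : Type*} [NormedAddCommGroup E]
    [NormedSpace ℝ E] [CompleteSpace E] {F : ℝ → E} (hF : Continuous F) :
    ∫ s in (0:ℝ)..1, ∫ t in (0:ℝ)..1, F (√s * t) = ∫ t in (0:ℝ)..1, F (1 - √t) := by
  rw [integral_comp_sqrt_unitInterval (G := fun u => ∫ t in (0:ℝ)..1, F (u * t))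
      (intervalIntegral.continuous_parametric_intervalIntegral_of_continuous' (by fun_prop) 0 1),
    integral_comp_sqrt_unitInterval (G := fun u => F (1 - u)) (by fun_prop)]
  have h := intervalIntegral.integral_comp_sub_left (a := 0) (b := 1)
    (fun u => (1 - u) • F u) 1
  simp only [sub_sub_cancel, sub_self, sub_zero] at h
  simp only [mul_smul, intervalIntegral.integral_smul, intervalIntegral.smul_integral_comp_mul_left,
    mul_zero, mul_one, integral_primitive_unitInterval hF, h]

/-- Example (a), formula (9): `𝒥^α(𝒥^{2α}(ν)) = L(∫₀¹ (1-√t)^{1/α} dY_ν(t))`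
at the level of Lévy exponents. -/
theorem example_a_levy_exponent {d : ℕ} (α : ℝ) (hα : 0 < α)
    (Φ : EuclideanSpace ℝ (Fin d) → ℂ) (hΦ : Continuous Φ)
    (y : EuclideanSpace ℝ (Fin d)) :
    (∫ s in (0:ℝ)..1, ∫ t in (0:ℝ)..1, Φ ((s ^ (1/(2*α)) * t ^ (1/α)) • y)) =
      (∫ t in (0:ℝ)..1, Φ (((1 - Real.sqrt (1 - t)) ^ (1/α)) • y)) ∧
    (∫ t in (0:ℝ)..1, Φ (((1 - Real.sqrt (1 - t)) ^ (1/α)) • y)) =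
      ∫ t in (0:ℝ)..1, Φ (((1 - Real.sqrt t) ^ (1/α)) • y) := by
  have reflect : (∫ t in (0:ℝ)..1, Φ (((1 - √(1 - t)) ^ (1/α)) • y)) =
      ∫ t in (0:ℝ)..1, Φ (((1 - √t) ^ (1/α)) • y) := by
    simpa using intervalIntegral.integral_comp_sub_left (a := 0) (b := 1)
      (fun t => Φ (((1 - √t) ^ (1/α)) • y)) 1
  refine ⟨?_, reflect⟩
  have hF : Continuous fun x : ℝ => Φ (x ^ (1/α) • y) :=
    hΦ.comp ((Real.continuous_rpow_const (by positivity)).smul continuous_const)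
  rw [reflect, ← integral_integral_sqrt_mul_unitInterval hF]
  refine intervalIntegral.integral_congr fun s hs => intervalIntegral.integral_congr fun t ht => ?_
  rw [Set.uIcc_of_le zero_le_one] at hs ht
  have hpow : s ^ (1/(2*α)) = √s ^ (1/α) := by
    rw [Real.sqrt_eq_rpow, ← Real.rpow_mul hs.1]
    congr 1
    field_simp
  simp only [hpow, Real.mul_rpow (Real.sqrt_nonneg s) ht.1]
end

section
/- Let 0 < p < 2, let α, β > 0 with α ≠ β, let a ∈ ℝ^d, let γ be a finite Borel measure on the unit sphere S of ℝ^d with γ̄ = ∫_S u γ(du), and let M_p be the associated p-stable Lévy measure. Define a^{(β)} := (β/(β+1))(a + b_{M_p,β}) and a^{(α,β)} := (α/(α+1))(a^{(β)} + b_{M_p^{(β)},α}). Then a^{(α,β)} = (αβ/((α+1)(β+1))) ( a + ((α+β+p+1)/((α+p)(β+p))) γ̄ ), and moreover a^{(α,β)} = (αβ/((α+p)(β+p))) a + x₀, where x₀ := (αβ(α+β+p+1))/((α+1)(β+1)(α+p)(β+p)) · ((p−1) a + γ̄). (Example (b), formula (11): 𝒥^α(𝒥^β(σ_p)) equals, up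 to the shift x₀, the convolution power σ_p^{*αβ/((α+p)(β+p))} of the stable law σ_p = [a,0,M_p].) -/
open MeasureTheory

/-- The `p`-stable Lévy measure associated with a finite measure `γ` on the
unit sphere: `M_p(A) = ∫_S ∫₀^∞ 1_A(r x) r^{-p-1} dr γ(dx)`. -/
noncomputable def stableLevyMeasure {d : ℕ} (p : ℝ)
    (γ : Measure (EuclideanSpace ℝ (Fin d))) : Measure (EuclideanSpace ℝ (Fin d)) :=
  γ.bind fun x =>
    Measure.map (fun r : ℝ => r • x)
      (((volume.restrict (Set.Ioi (0:ℝ))).withDensity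
        fun r => ENNReal.ofReal (r ^ (-p - 1))))

/-- The radial part `r^{-p-1} dr` on `(0,∞)` of the stable Lévy measure. -/
noncomputable def stableRadialMeasure (p : ℝ) : Measure ℝ :=
  (volume.restrict (Set.Ioi (0:ℝ))).withDensity fun r => ENNReal.ofReal (r ^ (-p - 1))

instance stableRadialMeasure.instSFinite (p : ℝ) : SFinite (stableRadialMeasure p) := by
  unfold stableRadialMeasure; infer_instance

theorem stableRadialMeasure_apply (p : ℝ) {A : Set ℝ} (hA : MeasurableSet A) :
    stableRadialMeasure p A =
      ∫⁻ r, (A ∩ Set.Ioi 0).indicator (fun r => ENNReal.ofReal (r ^ (-p - 1))) r := by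
  rw [stableRadialMeasure, withDensity_apply _ hA, Measure.restrict_restrict hA,
    lintegral_indicator (hA.inter measurableSet_Ioi)]

theorem stableRadialMeasure_map_mul_left (p : ℝ) {s : ℝ} (hs : 0 < s) :
    (stableRadialMeasure p).map (s * ·) = ENNReal.ofReal (s ^ p) • stableRadialMeasure p := by
  ext A hA
  have hm : Measurable (fun r : ℝ => s * r) := measurable_const_mul s
  have hdens : Measurable ((A ∩ Set.Ioi 0).indicator
      (fun r : ℝ => ENNReal.ofReal (r ^ (-p - 1)))) :=
    Measurable.indicator (by fun_prop) (hA.inter measurableSet_Ioi)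
  rw [Measure.map_apply hm hA, Measure.smul_apply, smul_eq_mul,
    stableRadialMeasure_apply p (hm hA), stableRadialMeasure_apply p hA]
  conv_rhs => rw [← Real.smul_map_volume_mul_left hs.ne']
  rw [lintegral_smul_measure, lintegral_map hdens hm, smul_eq_mul, ← mul_assoc,
    ← lintegral_const_mul _ (by exact hdens.comp hm)]
  congr 1 with r
  by_cases h : s * r ∈ A ∧ 0 < r
  · have h' : s * r ∈ A ∩ Set.Ioi 0 := ⟨h.1, mul_pos hs h.2⟩
    rw [Set.indicator_of_mem (show r ∈ _ ∩ _ from h), Set.indicator_of_mem h', abs_of_pos hs,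
      ← ENNReal.ofReal_mul (by positivity), ← ENNReal.ofReal_mul (by positivity),
      Real.mul_rpow hs.le h.2.le, ← mul_assoc]
    congr 1
    nth_rewrite 2 [← Real.rpow_one s]
    rw [← Real.rpow_add hs, ← Real.rpow_add hs]
    simp
  · have h' : s * r ∉ A ∩ Set.Ioi 0 := fun h' => h ⟨h'.1, pos_of_mul_pos_right h'.2 hs.le⟩
    rw [Set.indicator_of_notMem (show r ∉ _ ∩ _ from h), Set.indicator_of_notMem h', mul_zero]

section

variable {d : ℕ}

theorem stableLevyMeasure_eq_map_prod (p : ℝ) (γ : Measure (EuclideanSpace ℝ (Fin d)))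
    [IsFiniteMeasure γ] :
    stableLevyMeasure p γ =
      (γ.prod (stableRadialMeasure p)).map fun z => z.2 • z.1 := by
  have hm : Measurable fun z : EuclideanSpace ℝ (Fin d) × ℝ => z.2 • z.1 := by fun_prop
  have hx (x : EuclideanSpace ℝ (Fin d)) : Measurable fun r : ℝ => r • x := by fun_prop
  have hker : Measurable fun x : EuclideanSpace ℝ (Fin d) =>
      (stableRadialMeasure p).map fun r : ℝ => r • x := by
    refine Measure.measurable_of_measurable_coe _ fun A hA => ?_
    simp_rw [Measure.map_apply (hx _) hA]
    exact measurable_measure_prodMk_left (hm hA)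
  ext A hA
  change γ.bind (fun x => (stableRadialMeasure p).map fun r : ℝ => r • x) A = _
  rw [Measure.bind_apply hA hker.aemeasurable, Measure.map_apply hm hA,
    Measure.prod_apply (hm hA)]
  refine lintegral_congr fun x => ?_
  rw [Measure.map_apply (hx x) hA]
  rfl

theorem stableLevyMeasure_map_smul (p : ℝ) (γ : Measure (EuclideanSpace ℝ (Fin d)))
    [IsFiniteMeasure γ] {s : ℝ} (hs : 0 < s) :
    (stableLevyMeasure p γ).map (fun x => s • x) =
      ENNReal.ofReal (s ^ p) • stableLevyMeasure p γ := by
  have hm : Measurable fun z : EuclideanSpace ℝ (Fin d) × ℝ => z.2 • z.1 := by fun_prop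
  have hcomp : (fun x : EuclideanSpace ℝ (Fin d) => s • x) ∘ (fun z => z.2 • z.1) =
      (fun z : EuclideanSpace ℝ (Fin d) × ℝ => z.2 • z.1) ∘ Prod.map id (s * ·) := by
    ext z : 1
    simp [mul_smul]
  have hν := stableRadialMeasure_map_mul_left p hs
  rw [stableLevyMeasure_eq_map_prod, Measure.map_map (by fun_prop) hm, hcomp,
    ← Measure.map_map hm (by fun_prop),
    ← Measure.map_prod_map _ _ measurable_id (measurable_const_mul s), Measure.map_id, hν,
    Measure.prod_smul_right, Measure.map_smul]

theorem levyMeasureJ_stableLevyMeasure {p β : ℝ} (hp : 0 < p) (hβ : 0 < β)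
    (γ : Measure (EuclideanSpace ℝ (Fin d))) [IsFiniteMeasure γ] :
    levyMeasureJ (stableLevyMeasure p γ) β =
      ENNReal.ofReal (β / (β + p)) • stableLevyMeasure p γ := by
  have hker : Measurable fun t : ℝ =>
      ENNReal.ofReal (t ^ (p / β)) • stableLevyMeasure p γ := by
    refine Measure.measurable_of_measurable_coe _ fun A hA => ?_
    simp only [Measure.smul_apply, smul_eq_mul]
    fun_prop
  have hae : (fun t : ℝ => (stableLevyMeasure p γ).map fun x => (t ^ (1 / β)) • x)
      =ᵐ[volume.restrict (Set.Ioc (0:ℝ) 1)]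
        fun t => ENNReal.ofReal (t ^ (p / β)) • stableLevyMeasure p γ := by
    filter_upwards [ae_restrict_mem measurableSet_Ioc] with t ht
    rw [stableLevyMeasure_map_smul p γ (Real.rpow_pos_of_pos ht.1 _), ← Real.rpow_mul ht.1.le,
      one_div_mul_eq_div]
  have hpβ : 0 < p / β := by positivity
  have hint : ∫⁻ t in Set.Ioc (0:ℝ) 1, ENNReal.ofReal (t ^ (p / β)) =
      ENNReal.ofReal (β / (β + p)) := by
    rw [← ofReal_integral_eq_lintegral_ofReal]
    · rw [← intervalIntegral.integral_of_le zero_le_one, integral_rpow (Or.inl (by linarith)),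
        Real.one_rpow, Real.zero_rpow (by positivity)]
      congr 1
      field_simp
      ring
    · exact (intervalIntegrable_iff_integrableOn_Ioc_of_le zero_le_one).1
        (intervalIntegral.intervalIntegrable_rpow' (by linarith))
    · filter_upwards [ae_restrict_mem measurableSet_Ioc] with t ht
      exact Real.rpow_nonneg ht.1.le _
  ext A hA
  rw [levyMeasureJ, Measure.bind_apply hA (hker.aemeasurable.congr hae.symm),
    lintegral_congr_ae (hae.mono fun t ht => congrArg (· A) ht)]
  simp only [Measure.smul_apply, smul_eq_mul]
  rw [lintegral_mul_const _ (by fun_prop), hint]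

theorem integral_stableRadialMeasure_indicator_rpow {p q : ℝ} (hpq : 0 < q + p) :
    ∫ r, (Set.Ioi (1:ℝ)).indicator (fun r => r ^ (-q)) r ∂(stableRadialMeasure p) =
      1 / (q + p) := by
  rw [stableRadialMeasure, integral_withDensity_eq_integral_toReal_smul (by fun_prop)
    (Filter.Eventually.of_forall fun _ => ENNReal.ofReal_lt_top)]
  have h : ∀ r ∈ Set.Ioi (0:ℝ), (ENNReal.ofReal (r ^ (-p - 1))).toReal •
      (Set.Ioi (1:ℝ)).indicator (fun r => r ^ (-q)) r =
        (Set.Ioi (1:ℝ)).indicator (fun r => r ^ (-(q + p) - 1)) r := by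
    intro r hr
    rw [Set.mem_Ioi] at hr
    by_cases h1 : r ∈ Set.Ioi (1:ℝ)
    · rw [Set.indicator_of_mem h1, Set.indicator_of_mem h1,
        ENNReal.toReal_ofReal (by positivity), smul_eq_mul, ← Real.rpow_add hr]
      congr 1
      ring
    · rw [Set.indicator_of_notMem h1, Set.indicator_of_notMem h1, smul_zero]
  rw [setIntegral_congr_fun measurableSet_Ioi h, setIntegral_indicator measurableSet_Ioi,
    Set.Ioi_inter_Ioi, max_eq_right zero_le_one, integral_Ioi_rpow_of_lt (by linarith) one_pos]
  rw [Real.one_rpow, sub_add_cancel, neg_div_neg_eq]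

theorem setIntegral_stableLevyMeasure {p q : ℝ} (hpq : 0 < q + p)
    (γ : Measure (EuclideanSpace ℝ (Fin d))) [IsFiniteMeasure γ]
    (hγ : γ {x | ‖x‖ = 1}ᶜ = 0) :
    ∫ x in {x : EuclideanSpace ℝ (Fin d) | 1 < ‖x‖},
        (‖x‖ ^ (-1 - q)) • x ∂(stableLevyMeasure p γ) = (1 / (q + p)) • ∫ x, x ∂γ := by
  have hS : MeasurableSet {x : EuclideanSpace ℝ (Fin d) | 1 < ‖x‖} :=
    measurableSet_lt measurable_const measurable_norm
  have hF : Measurable ({x : EuclideanSpace ℝ (Fin d) | 1 < ‖x‖}.indicator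
      fun x => (‖x‖ ^ (-1 - q)) • x) := Measurable.indicator (by fun_prop) hS
  have hm : Measurable fun z : EuclideanSpace ℝ (Fin d) × ℝ => z.2 • z.1 := by fun_prop
  have hsphere : ∀ᵐ z ∂(γ.prod (stableRadialMeasure p)), ‖z.1‖ = 1 :=
    Measure.quasiMeasurePreserving_fst.ae (p := fun x => ‖x‖ = 1) hγ
  have hpos : ∀ᵐ z ∂(γ.prod (stableRadialMeasure p)), 0 < z.2 :=
    Measure.quasiMeasurePreserving_snd.ae (p := fun r => 0 < r)
      ((withDensity_absolutelyContinuous _ _).ae_le (ae_restrict_mem measurableSet_Ioi))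
  have hae : (fun z : EuclideanSpace ℝ (Fin d) × ℝ =>
      {x : EuclideanSpace ℝ (Fin d) | 1 < ‖x‖}.indicator
        (fun x => (‖x‖ ^ (-1 - q)) • x) (z.2 • z.1)) =ᵐ[γ.prod (stableRadialMeasure p)]
      fun z => (Set.Ioi (1:ℝ)).indicator (fun r => r ^ (-q)) z.2 • z.1 := by
    filter_upwards [hsphere, hpos] with z hz hr
    have hnorm : ‖z.2 • z.1‖ = z.2 := by
      rw [norm_smul, hz, mul_one, Real.norm_of_nonneg hr.le]
    by_cases h1 : 1 < z.2
    · rw [Set.indicator_of_mem (by simpa [hnorm] using h1), Set.indicator_of_mem (Set.mem_Ioi.2 h1),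
        hnorm, smul_smul]
      nth_rewrite 2 [← Real.rpow_one z.2]
      rw [← Real.rpow_add hr]
      ring_nf
    · rw [Set.indicator_of_notMem (by simpa [hnorm] using h1),
        Set.indicator_of_notMem (by simpa using h1), zero_smul]
  rw [← integral_indicator hS, stableLevyMeasure_eq_map_prod,
    integral_map hm.aemeasurable hF.aestronglyMeasurable, integral_congr_ae hae,
    ← integral_prod_swap]
  simp only [Prod.fst_swap, Prod.snd_swap]
  rw [integral_prod_smul (fun r => (Set.Ioi (1:ℝ)).indicator (fun r => r ^ (-q)) r) (fun x => x),
    integral_stableRadialMeasure_indicator_rpow hpq]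

end

/-- Example (b), formula (11): the shift vector of `𝒥^α(𝒥^β(σ_p))` for the
stable law `σ_p = [a,0,M_p]` equals
`(αβ/((α+1)(β+1)))(a + ((α+β+p+1)/((α+p)(β+p))) γ̄)`, i.e.
`(αβ/((α+p)(β+p))) a + x₀` with
`x₀ = (αβ(α+β+p+1))/((α+1)(β+1)(α+p)(β+p)) ((p-1) a + γ̄)`. -/
theorem stable_shift_vector {d : ℕ} (p α β : ℝ)
    (hp : 0 < p) (hp2 : p < 2) (hα : 0 < α) (hβ : 0 < β) (hαβ : α ≠ β)
    (a : EuclideanSpace ℝ (Fin d))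
    (γ : Measure (EuclideanSpace ℝ (Fin d))) [IsFiniteMeasure γ]
    (hγ : γ {x | ‖x‖ = 1}ᶜ = 0)
    (γbar bβ bβα aβ aαβ : EuclideanSpace ℝ (Fin d))
    (hγbar : γbar = ∫ x, x ∂γ)
    (hbβ : bβ = ∫ x in {x : EuclideanSpace ℝ (Fin d) | 1 < ‖x‖},
        (‖x‖ ^ (-1 - β)) • x ∂(stableLevyMeasure p γ))
    (hbβα : bβα = ∫ x in {x : EuclideanSpace ℝ (Fin d) | 1 < ‖x‖},
        (‖x‖ ^ (-1 - α)) • x ∂(levyMeasureJ (stableLevyMeasure p γ) β))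
    (haβ : aβ = (β / (β + 1)) • (a + bβ))
    (haαβ : aαβ = (α / (α + 1)) • (aβ + bβα)) :
    aαβ = (α * β / ((α + 1) * (β + 1))) •
        (a + ((α + β + p + 1) / ((α + p) * (β + p))) • γbar) ∧
    aαβ = (α * β / ((α + p) * (β + p))) • a
        + (α * β * (α + β + p + 1) / ((α + 1) * (β + 1) * (α + p) * (β + p))) •
            ((p - 1) • a + γbar) := by
  have hαp : 0 < α + p := by positivity
  have hβp : 0 < β + p := by positivity
  rw [setIntegral_stableLevyMeasure hβp γ hγ, ← hγbar] at hbβ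
  rw [levyMeasureJ_stableLevyMeasure hp hβ, Measure.restrict_smul, integral_smul_measure,
    setIntegral_stableLevyMeasure hαp γ hγ, ← hγbar, ENNReal.toReal_ofReal (by positivity)] at hbβα
  subst haαβ haβ hbβ hbβα
  constructor <;>
  · match_scalars <;> field_simp <;> ring
end
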